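/- (Second-moment bound in the dense regime.) For every α > 0 there exist constants c' > 0, c_μ > 0 and C* ≥ 1 such that the following holds for all positive integers d₁, d₂ and integers 1 ≤ s₁ ≤ d₁, 1 ≤ s₂ ≤ d₂ with s₁² ≥ (2e)^{−4}·d₁·s₂ and s₁ < c'·d₁, where c = 1 − exp( −c_μ·C*·(2e)^{−4}·log(C*/(2e)) ): (1) if c_μ^{−1}·s₂·log(c·d₂/s₂) ≤ C*·s₁²/d₁ and μ > 0 satisfies μ² < C*^{−1}·(d₁/s₁²)·log(c·d₂/s₂) + (c_μ/s₂)·log(C*/(2e)), then E[ exp(μ²·X·Y)·1(X ≥ ⌈C*·s₁²/d₁⌉) ] < α; (2) if C*·s₁²/d₁ < c_μ^{−1}·s₂·log(c·d₂/s₂) ≤ s₁ and μ² < (c_μ/s₂)·log( s₂·d₁·log(c·d₂/s₂)/(c_μ·2e·s₁²) ), then E[ exp(μ²·X·Y)·1(X ≥ ⌈C*·s₁²/d₁⌉) ] < α; (3) if s₁ < c_μ^{−1}·s₂·log(c·d₂/s₂) and μ² < (1/s₁)·log(c·d₂/s₂) + (c_μ/s₂)·log(d₁/(2e·s₁)), then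 E[ exp(μ²·X·Y)·1(X ≥ ⌈C*·s₁²/d₁⌉) ] < α. -/

import Mathlib

/-- The binomial point mass: P(X = k) for X ~ Binomial(n, p). -/
noncomputable def binomP (n : ℕ) (p : ℝ) (k : ℕ) : ℝ :=
  (n.choose k : ℝ) * p ^ k * (1 - p) ^ (n - k)

/-- Expectation E[f(X,Y)] for independent X ~ Binomial(s₁, s₁/d₁) and
Y ~ Binomial(s₂, s₂/d₂). -/
noncomputable def Eexp (s₁ s₂ d₁ d₂ : ℕ) (f : ℕ → ℕ → ℝ) : ℝ :=
  ∑ k ∈ Finset.range (s₁ + 1), ∑ l ∈ Finset.range (s₂ + 1),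
    binomP s₁ ((s₁ : ℝ) / (d₁ : ℝ)) k * binomP s₂ ((s₂ : ℝ) / (d₂ : ℝ)) l * f k l

/-- The moment generating function of a binomial variable. -/
lemma sum_binomP_mul_exp (n : ℕ) (p t : ℝ) :
    ∑ l ∈ Finset.range (n + 1), binomP n p l * Real.exp (t * l) =
      (p * Real.exp t + (1 - p)) ^ n := by
  rw [add_pow]
  refine Finset.sum_congr rfl fun l _ => ?_
  rw [binomP, mul_pow, ← Real.exp_nat_mul, mul_comm t]
  ring

lemma binomP_mul_pow_le (s d k : ℕ) (hd : 0 < d) (hs : 1 ≤ s) (hsd : s ≤ d) :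
    binomP s ((s : ℝ) / d) k * ((k : ℝ) * d / (2 * Real.exp 1 * (s : ℝ) ^ 2)) ^ k ≤
      (1 / 2) ^ k := by
  have hd' : (0 : ℝ) < d := by exact_mod_cast hd
  have hs' : (0 : ℝ) < s := by exact_mod_cast hs
  have hsd' : (s : ℝ) ≤ d := by exact_mod_cast hsd
  have hp : (s : ℝ) / d ≤ 1 := (div_le_one hd').2 hsd'
  have hp0 : 0 ≤ (s : ℝ) / d := by positivity
  have hq : (1 - (s : ℝ) / d) ^ (s - k) ≤ 1 := pow_le_one₀ (by linarith) (by linarith)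
  have hchoose : (s.choose k : ℝ) ≤ (s : ℝ) ^ k / (k.factorial : ℝ) := Nat.choose_le_pow_div k s
  have hfact : (k : ℝ) ^ k / (k.factorial : ℝ) ≤ Real.exp k :=
    Real.pow_div_factorial_le_exp k (Nat.cast_nonneg k) k
  have hb : binomP s ((s : ℝ) / d) k ≤
      (s : ℝ) ^ k / (k.factorial : ℝ) * ((s : ℝ) / d) ^ k := by
    unfold binomP
    calc _ ≤ (s.choose k : ℝ) * ((s : ℝ) / d) ^ k * 1 := by gcongr
      _ ≤ _ := by rw [mul_one]; gcongr
  calc _ ≤ (s : ℝ) ^ k / (k.factorial : ℝ) * ((s : ℝ) / d) ^ k *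
        ((k : ℝ) * d / (2 * Real.exp 1 * (s : ℝ) ^ 2)) ^ k := by gcongr
    _ = (k : ℝ) ^ k / (k.factorial : ℝ) *
        (s * (s / d) * (d / (2 * Real.exp 1 * (s : ℝ) ^ 2))) ^ k := by
        simp only [mul_pow, div_pow]; ring
    _ = (k : ℝ) ^ k / (k.factorial : ℝ) * (1 / (2 * Real.exp 1)) ^ k := by
        congr 2; field_simp
    _ ≤ Real.exp k * (1 / (2 * Real.exp 1)) ^ k := by gcongr
    _ = (1 / 2) ^ k := by
        rw [← mul_one (k : ℝ), Real.exp_nat_mul, ← mul_pow]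
        congr 1; field_simp

lemma Eexp_tail_le (s₁ s₂ d₁ d₂ N : ℕ) (t m : ℝ) (hd₁ : 0 < d₁) (hs₁ : 1 ≤ s₁) (hsd₁ : s₁ ≤ d₁)
    (hN : (N : ℝ) ≤ m)
    (h : ∀ k : ℕ, m ≤ k → k ≤ s₁ →
      ((s₂ : ℝ) / d₂ * Real.exp (t * k) + (1 - (s₂ : ℝ) / d₂)) ^ s₂ ≤
        ((k : ℝ) * d₁ / (2 * Real.exp 1 * (s₁ : ℝ) ^ 2)) ^ k) :
    Eexp s₁ s₂ d₁ d₂ (fun k l => Real.exp (t * (k : ℝ) * (l : ℝ)) *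
      (if ⌈m⌉₊ ≤ k then (1 : ℝ) else 0)) ≤ 2 * (1 / 2) ^ N := by
  have hp : (s₁ : ℝ) / d₁ ≤ 1 :=
    (div_le_one (by exact_mod_cast hd₁)).2 (by exact_mod_cast hsd₁)
  have key : ∀ k ∈ Finset.range (s₁ + 1),
      ∑ l ∈ Finset.range (s₂ + 1), binomP s₁ ((s₁ : ℝ) / d₁) k * binomP s₂ ((s₂ : ℝ) / d₂) l *
        (Real.exp (t * (k : ℝ) * (l : ℝ)) * (if ⌈m⌉₊ ≤ k then (1 : ℝ) else 0)) ≤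
      if N ≤ k then (1 / 2 : ℝ) ^ k else 0 := by
    intro k hk
    have hk' : k ≤ s₁ := Nat.lt_succ_iff.1 (Finset.mem_range.1 hk)
    by_cases hm : ⌈m⌉₊ ≤ k
    · have hmk : m ≤ k := Nat.ceil_le.1 hm
      have hNk : N ≤ k := by exact_mod_cast hN.trans hmk
      have hb : 0 ≤ binomP s₁ ((s₁ : ℝ) / d₁) k := by
        have : 0 ≤ 1 - (s₁ : ℝ) / d₁ := by linarith
        unfold binomP; positivity
      simp only [if_pos hm, if_pos hNk, mul_one, mul_assoc (binomP s₁ _ k)]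
      rw [← Finset.mul_sum, sum_binomP_mul_exp]
      exact (mul_le_mul_of_nonneg_left (h k hmk hk') hb).trans
        (binomP_mul_pow_le s₁ d₁ k hd₁ hs₁ hsd₁)
    · simp only [if_neg hm, mul_zero, Finset.sum_const_zero]
      split_ifs <;> positivity
  refine (Finset.sum_le_sum key).trans ?_
  rw [← Finset.sum_filter]
  have hsub : (Finset.range (s₁ + 1)).filter (fun k => N ≤ k) ⊆ Finset.Ico N (s₁ + 1) := by
    intro k hk
    simp only [Finset.mem_filter, Finset.mem_range] at hk
    exact Finset.mem_Ico.2 ⟨hk.2, hk.1⟩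
  refine (Finset.sum_le_sum_of_subset_of_nonneg hsub fun _ _ _ => by positivity).trans ?_
  refine (geom_sum_Ico_le_of_lt_one (by norm_num) (by norm_num)).trans (le_of_eq ?_)
  ring

lemma mix_pow_le (s d : ℕ) (D x A : ℝ) (hs : 1 ≤ s) (hd : 0 < d) (hsd : s ≤ d) (hD : 0 < D)
    (hA : D ≤ A / s) (hx : x ≤ Real.log ((1 - Real.exp (-D)) * d / s) + A / s) :
    ((s : ℝ) / d * Real.exp x + (1 - (s : ℝ) / d)) ^ s ≤ Real.exp A := by
  have hs' : (0 : ℝ) < s := by exact_mod_cast hs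
  have hd' : (0 : ℝ) < d := by exact_mod_cast hd
  have hc : 0 < 1 - Real.exp (-D) := by
    have : Real.exp (-D) < 1 := by simpa using hD
    linarith
  have hp : (s : ℝ) / d ≤ 1 := (div_le_one hd').2 (by exact_mod_cast hsd)
  have hpos : 0 ≤ (s : ℝ) / d * Real.exp x + (1 - (s : ℝ) / d) :=
    add_nonneg (by positivity) (by linarith)
  have h1 : (s : ℝ) / d * Real.exp x ≤ (1 - Real.exp (-D)) * Real.exp (A / s) := by
    calc _ ≤ (s : ℝ) / d * Real.exp (Real.log ((1 - Real.exp (-D)) * d / s) + A / s) := by gcongr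
      _ = _ := by
        rw [Real.exp_add, Real.exp_log (by positivity)]
        field_simp
  have h2 : 1 ≤ Real.exp (-D) * Real.exp (A / s) := by
    rw [← Real.exp_add]
    exact Real.one_le_exp (by linarith)
  have h3 : 0 ≤ (s : ℝ) / d := by positivity
  calc _ ≤ Real.exp (A / s) ^ s := pow_le_pow_left₀ hpos (by linarith) s
    _ = Real.exp A := by
      rw [← Real.exp_nat_mul]
      congr 1; field_simp

lemma mul_log_sub_log_le {a b : ℝ} (ha : 0 < a) (hb : 0 < b) :
    a * (Real.log b - Real.log a) ≤ b - a := by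
  have h := Real.log_le_sub_one_of_pos (div_pos hb ha)
  rw [Real.log_div hb.ne' ha.ne'] at h
  calc _ ≤ a * (b / a - 1) := by gcongr
    _ = b - a := by field_simp

/-- Second-moment bound in the dense regime (Lemma A.6). -/
theorem dense_regime_bound (α : ℝ) (hα : 0 < α) :
    ∃ c' cμ Cs : ℝ, 0 < c' ∧ 0 < cμ ∧ 1 ≤ Cs ∧
      ∀ (d₁ d₂ s₁ s₂ : ℕ), 0 < d₁ → 0 < d₂ →
        1 ≤ s₁ → s₁ ≤ d₁ → 1 ≤ s₂ → s₂ ≤ d₂ →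
        (2 * Real.exp 1) ^ 4 * (s₁ : ℝ) ^ 2 ≥ (d₁ : ℝ) * (s₂ : ℝ) →
        (s₁ : ℝ) < c' * (d₁ : ℝ) →
        ∀ c : ℝ,
          c = 1 - Real.exp (-(cμ * Cs * (1 / (2 * Real.exp 1) ^ 4) *
            Real.log (Cs / (2 * Real.exp 1)))) →
          ((cμ⁻¹ * (s₂ : ℝ) * Real.log (c * (d₂ : ℝ) / (s₂ : ℝ)) ≤
              Cs * (s₁ : ℝ) ^ 2 / (d₁ : ℝ) →
            ∀ μ : ℝ, 0 < μ →
              μ ^ 2 < Cs⁻¹ * ((d₁ : ℝ) / (s₁ : ℝ) ^ 2) *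
                  Real.log (c * (d₂ : ℝ) / (s₂ : ℝ)) +
                (cμ / (s₂ : ℝ)) * Real.log (Cs / (2 * Real.exp 1)) →
              Eexp s₁ s₂ d₁ d₂ (fun k l =>
                Real.exp (μ ^ 2 * (k : ℝ) * (l : ℝ)) *
                  (if ⌈Cs * (s₁ : ℝ) ^ 2 / (d₁ : ℝ)⌉₊ ≤ k
                    then (1 : ℝ) else 0)) < α) ∧
          (Cs * (s₁ : ℝ) ^ 2 / (d₁ : ℝ) <
              cμ⁻¹ * (s₂ : ℝ) * Real.log (c * (d₂ : ℝ) / (s₂ : ℝ)) →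
            cμ⁻¹ * (s₂ : ℝ) * Real.log (c * (d₂ : ℝ) / (s₂ : ℝ)) ≤ (s₁ : ℝ) →
            ∀ μ : ℝ, 0 < μ →
              μ ^ 2 < (cμ / (s₂ : ℝ)) *
                Real.log ((s₂ : ℝ) * (d₁ : ℝ) *
                    Real.log (c * (d₂ : ℝ) / (s₂ : ℝ)) /
                  (cμ * 2 * Real.exp 1 * (s₁ : ℝ) ^ 2)) →
              Eexp s₁ s₂ d₁ d₂ (fun k l =>
                Real.exp (μ ^ 2 * (k : ℝ) * (l : ℝ)) *
                  (if ⌈Cs * (s₁ : ℝ) ^ 2 / (d₁ : ℝ)⌉₊ ≤ k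
                    then (1 : ℝ) else 0)) < α) ∧
          ((s₁ : ℝ) < cμ⁻¹ * (s₂ : ℝ) * Real.log (c * (d₂ : ℝ) / (s₂ : ℝ)) →
            ∀ μ : ℝ, 0 < μ →
              μ ^ 2 < (1 / (s₁ : ℝ)) * Real.log (c * (d₂ : ℝ) / (s₂ : ℝ)) +
                (cμ / (s₂ : ℝ)) *
                  Real.log ((d₁ : ℝ) / (2 * Real.exp 1 * (s₁ : ℝ))) →
              Eexp s₁ s₂ d₁ d₂ (fun k l =>
                Real.exp (μ ^ 2 * (k : ℝ) * (l : ℝ)) *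
                  (if ⌈Cs * (s₁ : ℝ) ^ 2 / (d₁ : ℝ)⌉₊ ≤ k
                    then (1 : ℝ) else 0)) < α)) := by
  obtain ⟨N, hN⟩ : ∃ N : ℕ, (1 / 2 : ℝ) ^ N < α / 2 :=
    exists_pow_lt_of_lt_one (by positivity) (by norm_num)
  obtain ⟨Cs, hCs₁, hCs₂, hCsN⟩ : ∃ Cs : ℝ, 1 ≤ Cs ∧ 2 * Real.exp 1 * Real.exp 1 ≤ Cs ∧
      (2 * Real.exp 1) ^ 4 * N ≤ Cs :=
    ⟨max 1 (max (2 * Real.exp 1 * Real.exp 1) ((2 * Real.exp 1) ^ 4 * N)), le_max_left _ _,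
      (le_max_left _ _).trans (le_max_right _ _), (le_max_right _ _).trans (le_max_right _ _)⟩
  have hCs : 0 < Cs := by linarith
  refine ⟨1, 1 / 2, Cs, one_pos, by norm_num, hCs₁, ?_⟩
  intro d₁ d₂ s₁ s₂ hd₁ hd₂ hs₁ hsd₁ hs₂ hsd₂ hdense _ c hc
  have hd₁' : (0 : ℝ) < d₁ := by exact_mod_cast hd₁
  have hs₁' : (0 : ℝ) < s₁ := by exact_mod_cast hs₁
  have hs₂' : (1 : ℝ) ≤ s₂ := by exact_mod_cast hs₂
  have hs₂p : (0 : ℝ) < s₂ := by linarith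
  set Λ := Real.log (Cs / (2 * Real.exp 1)) with hΛdef
  have hΛ : 1 ≤ Λ := by
    rw [hΛdef, Real.le_log_iff_exp_le (by positivity), le_div_iff₀ (by positivity)]
    linarith
  set D := 1 / 2 * Cs * (1 / (2 * Real.exp 1) ^ 4) * Λ with hDdef
  have hD : 0 < D := by positivity
  set L := Real.log (c * d₂ / s₂) with hLdef
  set m := Cs * (s₁ : ℝ) ^ 2 / d₁ with hmdef
  have hm_lower : Cs * (1 / (2 * Real.exp 1) ^ 4) * s₂ ≤ m := by
    have h : (s₂ : ℝ) ≤ (2 * Real.exp 1) ^ 4 * (s₁ : ℝ) ^ 2 / d₁ := by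
      rw [le_div_iff₀ hd₁']; linarith
    calc _ ≤ Cs * (1 / (2 * Real.exp 1) ^ 4) * ((2 * Real.exp 1) ^ 4 * (s₁ : ℝ) ^ 2 / d₁) := by
          gcongr
      _ = m := by rw [hmdef]; field_simp
  have hm : 0 < m := by positivity
  have hNm : (N : ℝ) ≤ m := by
    have h1 : (N : ℝ) ≤ Cs * (1 / (2 * Real.exp 1) ^ 4) := by
      rw [mul_one_div, le_div_iff₀ (by positivity)]; linarith
    have h2 : Cs * (1 / (2 * Real.exp 1) ^ 4) * 1 ≤ Cs * (1 / (2 * Real.exp 1) ^ 4) * s₂ := by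
      gcongr
    linarith
  have hlog : ∀ x : ℝ, 0 < x →
      Real.log (x * d₁ / (2 * Real.exp 1 * (s₁ : ℝ) ^ 2)) = Λ + (Real.log x - Real.log m) := by
    intro x hx
    rw [hΛdef, ← Real.log_div hx.ne' hm.ne', ← Real.log_mul (by positivity) (by positivity)]
    congr 1
    rw [hmdef]; field_simp
  have reduction : ∀ t : ℝ, (∀ k : ℝ, m ≤ k → k ≤ s₁ →
      t * k ≤ L + k * (Λ + (Real.log k - Real.log m)) / s₂) →
      Eexp s₁ s₂ d₁ d₂ (fun k l => Real.exp (t * (k : ℝ) * (l : ℝ)) *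
        (if ⌈m⌉₊ ≤ k then (1 : ℝ) else 0)) < α := by
    intro t ht
    refine (Eexp_tail_le s₁ s₂ d₁ d₂ N t m hd₁ hs₁ hsd₁ hNm ?_).trans_lt (by linarith)
    intro k hmk hks
    have hk : (0 : ℝ) < k := hm.trans_le hmk
    have hA : D ≤ k * (Λ + (Real.log k - Real.log m)) / s₂ := by
      rw [le_div_iff₀ hs₂p]
      have h1 : Real.log m ≤ Real.log k := Real.log_le_log hm hmk
      have h2 : (k : ℝ) * Λ ≤ k * (Λ + (Real.log k - Real.log m)) := by gcongr; linarith
      have h3 : Cs * (1 / (2 * Real.exp 1) ^ 4) * s₂ * Λ ≤ k * Λ := by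
        gcongr; exact hm_lower.trans hmk
      have h4 : 0 ≤ Cs * (1 / (2 * Real.exp 1) ^ 4) * s₂ * Λ := by positivity
      rw [hDdef]
      linarith
    have hx := ht k hmk (by exact_mod_cast hks)
    rw [hLdef, hc] at hx
    refine (mix_pow_le s₂ d₂ D _ _ hs₂ hd₂ hsd₂ hD hA hx).trans (le_of_eq ?_)
    rw [← hlog k hk, Real.exp_nat_mul, Real.exp_log (by positivity)]
  have bracket : ∀ k : ℝ, m ≤ k → 0 ≤ k * (Λ + (Real.log k - Real.log m)) / s₂ := by
    intro k hmk
    have h1 : Real.log m ≤ Real.log k := Real.log_le_log hm hmk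
    have hk : 0 < k := hm.trans_le hmk
    have : 0 ≤ Λ + (Real.log k - Real.log m) := by linarith
    positivity
  refine ⟨?_, ?_, ?_⟩
  · intro hL μ _ hμ
    refine reduction _ fun k hmk hks => ?_
    have hk : 0 < k := hm.trans_le hmk
    have hcoef : Cs⁻¹ * ((d₁ : ℝ) / (s₁ : ℝ) ^ 2) = 1 / m := by rw [hmdef]; field_simp
    rw [hcoef] at hμ
    have hL' : L ≤ m / s₂ / 2 := by
      rw [div_div, le_div_iff₀ (by positivity)]
      norm_num at hL
      linarith
    have h1 : Real.log m ≤ Real.log k := Real.log_le_log hm hmk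
    have h2 : (k / m - 1) * L ≤ (k / m - 1) * (m / s₂ / 2) :=
      mul_le_mul_of_nonneg_left hL' (by rw [sub_nonneg, le_div_iff₀ hm]; linarith)
    have h3 : (k / m - 1) * (m / s₂ / 2) = k / s₂ / 2 - m / s₂ / 2 := by field_simp
    have h4 : 0 ≤ m / s₂ := by positivity
    have h5 : k / s₂ * 1 ≤ k / s₂ * Λ := by gcongr
    have h6 : k / s₂ * Λ ≤ k / s₂ * (Λ + (Real.log k - Real.log m)) := by gcongr; linarith
    calc μ ^ 2 * k ≤ (1 / m * L + 1 / 2 / s₂ * Λ) * k := by gcongr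
      _ = L + (k / m - 1) * L + k / s₂ * Λ / 2 := by ring
      _ ≤ L + k / s₂ * (Λ + (Real.log k - Real.log m)) := by linarith
      _ = _ := by ring
  · intro hq _ μ _ hμ
    refine reduction _ fun k hmk hks => ?_
    have hk : 0 < k := hm.trans_le hmk
    set q := (1 / 2 : ℝ)⁻¹ * s₂ * L with hqdef
    have hq0 : 0 < q := hm.trans hq
    have harg : (s₂ : ℝ) * d₁ * L / (1 / 2 * 2 * Real.exp 1 * (s₁ : ℝ) ^ 2) =
        q * d₁ / (2 * Real.exp 1 * (s₁ : ℝ) ^ 2) := by rw [hqdef]; field_simp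
    rw [harg, hlog q hq0] at hμ
    have hLq : L = q / s₂ / 2 := by rw [hqdef]; field_simp
    have h2 : 0 < k / s₂ := by positivity
    have h1 : k * (Real.log q - Real.log k) / s₂ ≤ (q - k) / s₂ := by
      gcongr; exact mul_log_sub_log_le hk hq0
    calc μ ^ 2 * k ≤ 1 / 2 / s₂ * (Λ + (Real.log q - Real.log m)) * k := by gcongr
      _ = k * (Λ + (Real.log k - Real.log m)) / s₂ / 2 +
          k * (Real.log q - Real.log k) / s₂ / 2 := by ring
      _ ≤ k * (Λ + (Real.log k - Real.log m)) / s₂ + (q - k) / s₂ / 2 := by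
        linarith [bracket k hmk]
      _ ≤ _ := by rw [hLq, sub_div]; linarith
  · intro hq μ _ hμ
    refine reduction _ fun k hmk hks => ?_
    have hk : 0 < k := hm.trans_le hmk
    have harg : (d₁ : ℝ) / (2 * Real.exp 1 * s₁) =
        s₁ * d₁ / (2 * Real.exp 1 * (s₁ : ℝ) ^ 2) := by field_simp
    rw [harg, hlog s₁ hs₁'] at hμ
    have hL : s₁ / s₂ / 2 ≤ L := by
      rw [div_div, div_le_iff₀ (by positivity)]
      norm_num at hq
      linarith
    have h1 : k * (Real.log s₁ - Real.log k) / s₂ ≤ (s₁ - k) / s₂ := by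
      gcongr; exact mul_log_sub_log_le hk hs₁'
    have h2 : (1 - k / s₁) * (s₁ / s₂ / 2) ≤ (1 - k / s₁) * L :=
      mul_le_mul_of_nonneg_left hL (by rw [sub_nonneg, div_le_one hs₁']; exact hks)
    have h3 : (1 - k / s₁) * (s₁ / s₂ / 2) = (s₁ - k) / s₂ / 2 := by field_simp
    calc μ ^ 2 * k ≤ (1 / s₁ * L + 1 / 2 / s₂ * (Λ + (Real.log s₁ - Real.log m))) * k := by gcongr
      _ = L - (1 - k / s₁) * L + k * (Λ + (Real.log k - Real.log m)) / s₂ / 2 +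
          k * (Real.log s₁ - Real.log k) / s₂ / 2 := by ring
      _ ≤ _ := by linarith [bracket k hmk]
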